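/- Let R be a Noetherian commutative ring and q an ideal of R. There exists an integer t_0 ≥ 1 such that the set of associated primes Ass(R/q^t) is the same for all t ≥ t_0; in particular the union ⋃_{t ≥ 1} Ass(R/q^t) is a finite set of primes. -/

import Mathlib

open Polynomial

/-- Elementwise description of the associated primes of `R/I`. -/
theorem brod_mem_ass_iff {R : Type*} [CommRing R] [IsNoetherianRing R] (I P : Ideal R) :
    P ∈ associatedPrimes R (R ⧸ I) ↔ P.IsPrime ∧ ∃ x : R, ∀ r, r ∈ P ↔ r * x ∈ I := by
  rw [AssociatedPrimes.mem_iff, isAssociatedPrime_iff]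
  refine and_congr_right fun _ => ?_
  constructor
  · rintro ⟨x, hx⟩
    obtain ⟨x, rfl⟩ := Ideal.Quotient.mk_surjective x
    refine ⟨x, fun r => ?_⟩
    rw [hx, Submodule.mem_colon_singleton, Submodule.mem_bot, ← Ideal.Quotient.eq_zero_iff_mem,
      map_mul]
    rfl
  · rintro ⟨x, hx⟩
    refine ⟨Ideal.Quotient.mk I x, ?_⟩
    ext r
    rw [hx, Submodule.mem_colon_singleton, Submodule.mem_bot, ← Ideal.Quotient.eq_zero_iff_mem,
      map_mul]
    rfl

/-- Associated primes of `q^t/q^(t+1)`. -/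
def brodB {R : Type*} [CommRing R] (q : Ideal R) (t : ℕ) : Set (Ideal R) :=
  {P | P.IsPrime ∧ ∃ x ∈ q ^ t, ∀ r, r ∈ P ↔ r * x ∈ q ^ (t + 1)}

theorem brod_B_sub {R : Type*} [CommRing R] [IsNoetherianRing R] (q : Ideal R) (t : ℕ) :
    brodB q t ⊆ associatedPrimes R (R ⧸ q ^ (t + 1)) := by
  rintro P ⟨hP, x, -, hx⟩
  exact (brod_mem_ass_iff _ _).2 ⟨hP, x, hx⟩

theorem brod_A_sub {R : Type*} [CommRing R] [IsNoetherianRing R] (q : Ideal R) (t : ℕ) :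
    associatedPrimes R (R ⧸ q ^ (t + 1)) ⊆ associatedPrimes R (R ⧸ q ^ t) ∪ brodB q t := by
  intro P h
  obtain ⟨hP, x, hx⟩ := (brod_mem_ass_iff _ _).1 h
  by_cases hr : ∃ r, r ∉ P ∧ r * x ∈ q ^ t
  · obtain ⟨r, hrP, hr⟩ := hr
    refine Or.inr ⟨hP, r * x, hr, fun s => ?_⟩
    rw [← mul_assoc, ← hx]
    exact ⟨fun h => P.mul_mem_right _ h, fun h => (hP.mem_or_mem h).resolve_right hrP⟩
  · push Not at hr
    refine Or.inl ((brod_mem_ass_iff _ _).2 ⟨hP, x, fun r => ⟨fun h => ?_, fun h => ?_⟩⟩)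
    · exact Ideal.pow_le_pow_right (Nat.le_succ t) ((hx r).1 h)
    · by_contra h'
      exact hr r h' h

/-- Contraction: annihilator primes over `R` come from associated primes over `S`. -/
theorem brod_contract {R S : Type*} [CommRing R] [CommRing S] [Algebra R S] [IsNoetherianRing S]
    (J : Ideal S) (P : Ideal R) (hP : P.IsPrime) (m : S)
    (hm : ∀ r, r ∈ P ↔ algebraMap R S r * m ∈ J) :
    P ∈ (fun Q : Ideal S => Q.comap (algebraMap R S)) '' associatedPrimes S (S ⧸ J) := by
  let T : Set (Ideal S) := {Q | ∃ s : S, (∀ f, f ∈ Q ↔ f * s ∈ J) ∧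
    ∀ r, r ∈ P ↔ algebraMap R S r ∈ Q}
  have key : ∀ s : S, ∃ Q : Ideal S, ∀ f, f ∈ Q ↔ f * s ∈ J := fun s =>
    ⟨Submodule.comap (LinearMap.mulRight S s) J, fun f => Iff.rfl⟩
  have hT : T.Nonempty := by
    obtain ⟨Q, hQ⟩ := key m
    exact ⟨Q, m, hQ, fun r => by rw [hQ, hm]⟩
  obtain ⟨Q, ⟨s, hs, hQ⟩, hmax⟩ := set_has_maximal_iff_noetherian.2 ‹IsNoetherianRing S› T hT
  -- any strictly bigger annihilator contains an element of `R` outside `P`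
  have step : ∀ f g, f ∉ Q ∨ f ∈ Q → g ∉ Q → f * g ∈ Q →
      f ∉ Q → ∃ r, r ∉ P ∧ algebraMap R S r * g ∈ Q := by
    intro f g _ _ hfg hf
    obtain ⟨Q', hQ'⟩ := key (g * s)
    have hlt : Q < Q' := by
      refine lt_of_le_of_ne (fun a ha => ?_) ?_
      · rw [hQ', mul_left_comm]
        exact J.mul_mem_left _ ((hs a).1 ha)
      · rintro rfl
        apply hf
        rw [hQ', ← mul_assoc, ← hs]
        exact hfg
    by_contra hcon
    push Not at hcon
    refine hmax Q' ⟨g * s, hQ', fun r => ⟨fun hr => hlt.le ((hQ r).1 hr), fun hr => ?_⟩⟩ hlt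
    by_contra hr'
    apply hcon r hr'
    rw [hs, mul_assoc, ← hQ']
    exact hr
  have hprime : Ideal.IsPrime (Q : Ideal S) := by
    refine ⟨?_, ?_⟩
    · rintro rfl
      apply hP.ne_top
      rw [Ideal.eq_top_iff_one, hQ]
      trivial
    · intro f g hfg
      by_contra hcon
      push Not at hcon
      obtain ⟨hf, hg⟩ := hcon
      obtain ⟨r, hr, hrg⟩ := step f g (em' _) hg hfg hf
      have hr' : algebraMap R S r ∉ Q := fun h => hr ((hQ r).2 h)
      obtain ⟨r', hr1, hr2⟩ := step g (algebraMap R S r) (em' _) hr' (by rwa [mul_comm]) hg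
      rw [← map_mul, ← hQ] at hr2
      exact (hP.mem_or_mem hr2).elim hr1 hr
  refine ⟨Q, (brod_mem_ass_iff J Q).2 ⟨hprime, s, hs⟩, ?_⟩
  ext r
  exact (hQ r).symm

theorem brod_contract_finite {R S : Type*} [CommRing R] [CommRing S] [Algebra R S]
    [IsNoetherianRing S] (J : Ideal S) :
    ((fun Q : Ideal S => Q.comap (algebraMap R S)) '' associatedPrimes S (S ⧸ J)).Finite :=
  (associatedPrimes.finite S (S ⧸ J)).image _

/-- The ideal `q S` of the Rees algebra `S`. -/
def brodJ {R : Type*} [CommRing R] (q : Ideal R) : Ideal (reesAlgebra q) where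
  carrier := {f | ∀ i, (f : R[X]).coeff i ∈ q ^ (i + 1)}
  zero_mem' := fun i => by simp
  add_mem' := fun {f g} hf hg i => by
    simpa using add_mem (hf i) (hg i)
  smul_mem' := fun g f hf i => by
    have : ((g • f : reesAlgebra q) : R[X]) = (g : R[X]) * (f : R[X]) := rfl
    rw [this, coeff_mul]
    refine Ideal.sum_mem _ fun c hc => ?_
    rw [← Finset.HasAntidiagonal.mem_antidiagonal.1 hc, add_assoc, pow_add]
    exact Ideal.mul_mem_mul (g.2 _) (hf _)

/-- Auxiliary ideals of elements killed by the irrelevant ideal, vanishing in high degree. -/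
def brodI {R : Type*} [CommRing R] (q : Ideal R) (n : ℕ) : Ideal (reesAlgebra q) where
  carrier := {f | (∀ i, ∀ a ∈ q, a * (f : R[X]).coeff i ∈ q ^ (i + 2)) ∧
    ∀ i, n < i → (f : R[X]).coeff i ∈ q ^ (i + 1)}
  zero_mem' := ⟨fun i a _ => by simp, fun i _ => by simp⟩
  add_mem' := fun {f g} hf hg => ⟨fun i a ha => by
      simpa [mul_add] using add_mem (hf.1 i a ha) (hg.1 i a ha), fun i hi => by
      simpa using add_mem (hf.2 i hi) (hg.2 i hi)⟩
  smul_mem' := fun g f hf => by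
    have : ((g • f : reesAlgebra q) : R[X]) = (g : R[X]) * (f : R[X]) := rfl
    simp only [Set.mem_ofPred_eq, this, coeff_mul]
    refine ⟨fun i a ha => ?_, fun i hi => Ideal.sum_mem _ fun c hc => ?_⟩
    · rw [Finset.mul_sum]
      refine Ideal.sum_mem _ fun c hc => ?_
      rw [← Finset.HasAntidiagonal.mem_antidiagonal.1 hc, add_assoc, pow_add, mul_left_comm]
      exact Ideal.mul_mem_mul (g.2 _) (hf.1 _ a ha)
    · obtain ⟨j, k⟩ := c
      have hjk : j + k = i := Finset.HasAntidiagonal.mem_antidiagonal.1 hc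
      subst hjk
      rcases j with _ | j
      · simp only [zero_add] at hi ⊢
        exact Ideal.mul_mem_left _ _ (hf.2 k hi)
      · have hg : (g : R[X]).coeff (j + 1) ∈ q ^ (j + 1) := g.2 _
        rw [pow_succ] at hg
        refine Submodule.mul_induction_on hg (fun b hb a ha => ?_) (fun u v hu hv => ?_)
        · have e : j + 1 + k + 1 = j + (k + 2) := by ring
          rw [e, pow_add, mul_assoc]
          exact Ideal.mul_mem_mul hb (hf.1 k a ha)
        · rw [add_mul]
          exact add_mem hu hv

theorem brod_B_finite {R : Type*} [CommRing R] [IsNoetherianRing R] (q : Ideal R) :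
    ∃ F : Set (Ideal R), F.Finite ∧ ∀ t, brodB q t ⊆ F := by
  refine ⟨_, brod_contract_finite (R := R) (brodJ q), ?_⟩
  rintro t P ⟨hP, x, hx, h⟩
  refine brod_contract (brodJ q) P hP ⟨monomial t x, reesAlgebra.monomial_mem.2 hx⟩ fun r => ?_
  have e : ((algebraMap R (reesAlgebra q) r * ⟨monomial t x, reesAlgebra.monomial_mem.2 hx⟩ :
    reesAlgebra q) : R[X]) = monomial t (r * x) := by
    change algebraMap R R[X] r * monomial t x = _
    rw [← C_mul_monomial]
    rfl
  rw [h]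
  change _ ↔ ∀ i, _
  simp only [e, coeff_monomial]
  constructor
  · intro h i
    split_ifs with hi
    · subst hi
      exact h
    · simp
  · intro h
    simpa using h t

theorem brod_exists_t {R : Type*} [CommRing R] [IsNoetherianRing R] (q : Ideal R) :
    ∃ t₀ : ℕ, ∀ t, t₀ ≤ t → ∀ x ∈ q ^ t, (∀ a ∈ q, a * x ∈ q ^ (t + 2)) → x ∈ q ^ (t + 1) := by
  have hmono : Monotone (brodI q) := fun m n hmn f hf =>
    ⟨hf.1, fun i hi => hf.2 i (lt_of_le_of_lt hmn hi)⟩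
  obtain ⟨n, hn⟩ := monotone_stabilizes_iff_noetherian.2
    (inferInstance : IsNoetherianRing (reesAlgebra q)) ⟨brodI q, hmono⟩
  refine ⟨n + 1, fun t ht x hx h => ?_⟩
  have hmem : (⟨monomial t x, reesAlgebra.monomial_mem.2 hx⟩ : reesAlgebra q) ∈ brodI q t := by
    refine ⟨fun i a ha => ?_, fun i hi => ?_⟩
    · simp only [coeff_monomial]
      split_ifs with hi
      · subst hi
        exact h a ha
      · simp
    · simp only [coeff_monomial, if_neg hi.ne]
      simp
  have e : brodI q n = brodI q t := hn t (by omega)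
  rw [← e] at hmem
  have := hmem.2 t (by omega)
  simpa using this

theorem brod_B_mono {R : Type*} [CommRing R] [IsNoetherianRing R] (q : Ideal R) :
    ∃ t₀ : ℕ, ∀ t, t₀ ≤ t → brodB q t ⊆ brodB q (t + 1) := by
  obtain ⟨t₀, h₀⟩ := brod_exists_t q
  refine ⟨t₀, ?_⟩
  rintro t ht P ⟨hP, x, hx, h⟩
  obtain ⟨s, hs⟩ : q.FG := IsNoetherian.noetherian q
  let K : R → Ideal R := fun a => Submodule.comap (LinearMap.mulRight R (a * x)) (q ^ (t + 2))
  have hK : ∀ a r, r ∈ K a ↔ r * (a * x) ∈ q ^ (t + 2) := fun a r => Iff.rfl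
  have hle : s.inf K ≤ P := by
    intro r hr
    rw [h]
    apply h₀ t ht _ (Ideal.mul_mem_left _ _ hx)
    intro a ha
    rw [← hs] at ha
    refine Submodule.span_induction (fun a ha => ?_) (by simp) (fun u v _ _ hu hv => ?_)
      (fun c u _ hu => ?_) ha
    · rw [mul_left_comm, ← hK]
      exact (Finset.inf_le (f := K) ha) hr
    · rw [add_mul]
      exact add_mem hu hv
    · rw [smul_eq_mul, mul_assoc]
      exact Ideal.mul_mem_left _ _ hu
  obtain ⟨a, ha, haP⟩ := (Ideal.IsPrime.inf_le' hP).1 hle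
  have haq : a ∈ q := by
    rw [← hs]
    exact Submodule.subset_span ha
  refine ⟨hP, a * x, ?_, fun r => ⟨fun hr => ?_, fun hr => haP hr⟩⟩
  · rw [pow_succ']
    exact Ideal.mul_mem_mul haq hx
  · rw [mul_left_comm, pow_succ']
    exact Ideal.mul_mem_mul haq ((h r).1 hr)

theorem brod_antitone {α : Type*} (s : ℕ → Set α) (t₀ : ℕ) (hf : ∀ n, t₀ ≤ n → (s n).Finite)
    (h : ∀ n, t₀ ≤ n → s (n + 1) ⊆ s n) :
    ∃ N, t₀ ≤ N ∧ ∀ n, N ≤ n → s n = s N := by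
  classical
  have hex : ∃ c, ∃ n, t₀ ≤ n ∧ (s n).ncard = c := ⟨_, t₀, le_rfl, rfl⟩
  obtain ⟨N, hN, hc⟩ := Nat.find_spec hex
  refine ⟨N, hN, fun n hn => ?_⟩
  have hsub : s n ⊆ s N := by
    induction n, hn using Nat.le_induction with
    | base => exact subset_rfl
    | succ k hk ih => exact (h k (hN.trans hk)).trans ih
  refine Set.eq_of_subset_of_ncard_le hsub ?_ (hf N hN)
  rw [hc]
  exact Nat.find_min' hex ⟨n, hN.trans hn, rfl⟩

/-- Brodmann's theorem: the associated primes of `R/q^t` stabilize for large `t`;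
in particular `⋃_{t ≥ 1} Ass(R/q^t)` is finite. -/
theorem ass_powers_stabilize {R : Type*} [CommRing R] [IsNoetherianRing R] (q : Ideal R) :
    ∃ t₀ : ℕ, 1 ≤ t₀ ∧
      (∀ t, t₀ ≤ t → associatedPrimes R (R ⧸ q ^ t) = associatedPrimes R (R ⧸ q ^ t₀)) ∧
      (⋃ t ∈ {t : ℕ | 1 ≤ t}, associatedPrimes R (R ⧸ q ^ t)).Finite := by
  obtain ⟨F, hF, hBF⟩ := brod_B_finite q
  obtain ⟨t₁, h₁⟩ := brod_B_mono q
  obtain ⟨t₂, -, h₂⟩ := brod_antitone (fun n => F \ brodB q n) t₁ (fun n _ => hF.sdiff)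
    (fun n hn => Set.sdiff_subset_sdiff_right (h₁ n hn))
  have hB : ∀ n, t₂ ≤ n → brodB q n = brodB q t₂ := by
    intro n hn
    have := h₂ n hn
    rw [← Set.sdiff_sdiff_cancel_left (hBF n), this, Set.sdiff_sdiff_cancel_left (hBF t₂)]
  obtain ⟨t₀, h₀, hA⟩ := brod_antitone (fun n => associatedPrimes R (R ⧸ q ^ n)) (t₂ + 1)
    (fun n _ => associatedPrimes.finite R _) (by
      intro n hn P hP
      rcases brod_A_sub q n hP with h | h
      · exact h
      · obtain ⟨k, rfl⟩ : ∃ k, n = k + 1 := ⟨n - 1, by omega⟩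
        apply brod_B_sub q k
        rw [hB k (by omega), ← hB (k + 1) (by omega)]
        exact h)
  refine ⟨t₀, by omega, hA, ?_⟩
  refine ((Set.finite_Iic t₀).biUnion (t := fun n => associatedPrimes R (R ⧸ q ^ n))
    (fun n _ => associatedPrimes.finite R _)).subset ?_
  refine Set.iUnion₂_subset fun t _ => ?_
  rcases le_total t t₀ with h | h
  · exact Set.subset_biUnion_of_mem (u := fun n => associatedPrimes R (R ⧸ q ^ n)) h
  · rw [hA t h]
    exact Set.subset_biUnion_of_mem (u := fun n => associatedPrimes R (R ⧸ q ^ n))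
      (Set.mem_Iic.2 le_rfl)
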